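/- arXiv:1709.00598 — 4 statements merged into one kernel-verified Lean document; each statement's English description precedes it below -/
import Mathlib

section
/- Let q be a prime power, n ≤ m, and let C ≤ F_{q^m}^n be an F_{q^m}-linear rank metric code with minimum distance d. If u, v ∈ C both have rank weight d, then supp(u) = supp(v) if and only if there exists α ∈ F_{q^m}, α ≠ 0, with u = α v. -/
open Polynomial

/-- The `q`-ary Gaussian binomial coefficient `[a choose b]_q`. -/
def gaussBinom (q a b : ℕ) : ℕ :=
  if b ≤ a then
    (∏ i ∈ Finset.range b, (q ^ (a - i) - 1)) / (∏ i ∈ Finset.range b, (q ^ (i + 1) - 1))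
  else 0

section Dual

variable (K : Type) [Field K] {n : ℕ}

/-- The linear functional `v ↦ ∑ i, u i * v i` given by the standard inner product. -/
def dotL (u : Fin n → K) : (Fin n → K) →ₗ[K] K where
  toFun v := ∑ i, u i * v i
  map_add' a b := by simp [mul_add, Finset.sum_add_distrib]
  map_smul' c a := by simp [Finset.mul_sum, mul_left_comm]

/-- The dual code with respect to the standard inner product. -/
def dualCode (C : Submodule K (Fin n → K)) : Submodule K (Fin n → K) :=
  ⨅ u ∈ C, LinearMap.ker (dotL K u)

end Dual

section RankMetric

variable (Fq K : Type) [Field Fq] [Field K] [Algebra Fq K] {n : ℕ}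

/-- The rank weight of a vector `v ∈ K^n`, `K = F_{q^m}`, over `Fq`. -/
noncomputable def rankWt (v : Fin n → K) : ℕ :=
  Module.finrank Fq (Submodule.span Fq (Set.range v))

/-- The support of `v ∈ K^n`: the `Fq`-subspace of `Fq^n` of all coordinatewise
images of `v` under `Fq`-linear functionals of `K`. -/
def rsupp (v : Fin n → K) : Submodule Fq (Fin n → Fq) :=
  Submodule.span Fq {w : Fin n → Fq | ∃ f : K →ₗ[Fq] Fq, w = fun i => f (v i)}

/-- The support of an `K`-linear code `C ≤ K^n`. -/
def codeSupp (C : Submodule K (Fin n → K)) : Submodule Fq (Fin n → Fq) :=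
  ⨆ v ∈ C, rsupp Fq K v

/-- `C` has minimum rank distance `d`. -/
def IsMinRankDist (C : Submodule K (Fin n → K)) (d : ℕ) : Prop :=
  (∃ c ∈ C, c ≠ 0 ∧ rankWt Fq K c = d) ∧ ∀ c ∈ C, c ≠ 0 → d ≤ rankWt Fq K c

/-- The `r`-th generalized rank weight of `C`. -/
noncomputable def genRankWt (C : Submodule K (Fin n → K)) (r : ℕ) : ℕ :=
  sInf {w | ∃ D : Submodule K (Fin n → K), D ≤ C ∧ Module.finrank K D = r ∧
    Module.finrank Fq (codeSupp Fq K D) = w}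

end RankMetric

/-- A `q`-Steiner system `S_q(t,k,n)` with block set `B`: every block is a
`k`-dimensional `Fq`-subspace of `Fq^n`, and every `t`-dimensional subspace is
contained in exactly one block. -/
def IsSteinerSystemQ (Fq : Type) [Field Fq] (t k n : ℕ)
    (B : Set (Submodule Fq (Fin n → Fq))) : Prop :=
  (∀ b ∈ B, Module.finrank Fq b = k) ∧
  ∀ W : Submodule Fq (Fin n → Fq), Module.finrank Fq W = t → ∃! b, b ∈ B ∧ W ≤ b

section RankSupport

variable (Fq K : Type) [Field Fq] [Field K] [Algebra Fq K] {n : ℕ}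

/-- The rank weight is the rank of the map `a ↦ ∑ i, a i • v i`. -/
theorem rankWt_eq_finrank_range (v : Fin n → K) :
    rankWt Fq K v = Module.finrank Fq (LinearMap.range (Fintype.linearCombination Fq v)) := by
  rw [Fintype.range_linearCombination, rankWt]

theorem rankWt_zero : rankWt Fq K (0 : Fin n → K) = 0 := by
  have h : Submodule.span Fq (Set.range (0 : Fin n → K)) = ⊥ := by
    rw [Submodule.span_eq_bot]
    rintro _ ⟨i, rfl⟩
    rfl
  rw [rankWt, h, finrank_bot]

theorem rankWt_pos {v : Fin n → K} (hv : v ≠ 0) : 0 < rankWt Fq K v := by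
  obtain ⟨i, hi⟩ := Function.ne_iff.mp hv
  have : FiniteDimensional Fq (Submodule.span Fq (Set.range v)) :=
    FiniteDimensional.span_of_finite Fq (Set.finite_range v)
  have : Nontrivial (Submodule.span Fq (Set.range v)) :=
    ⟨⟨⟨v i, Submodule.subset_span ⟨i, rfl⟩⟩, 0, fun h => hi (congrArg Subtype.val h)⟩⟩
  exact Module.finrank_pos

/-- The kernel of `a ↦ ∑ i, a i • v i` is the orthogonal complement of the support of `v`. -/
theorem linearCombination_eq_zero_iff (v : Fin n → K) (a : Fin n → Fq) :
    Fintype.linearCombination Fq v a = 0 ↔ ∀ w ∈ rsupp Fq K v, dotL Fq a w = 0 := by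
  have key : ∀ f : K →ₗ[Fq] Fq,
      dotL Fq a (fun i => f (v i)) = f (Fintype.linearCombination Fq v a) := by
    intro f
    simp [dotL, Fintype.linearCombination_apply]
  constructor
  · intro h w hw
    have hle : rsupp Fq K v ≤ LinearMap.ker (dotL Fq a) := by
      refine Submodule.span_le.mpr ?_
      rintro _ ⟨f, rfl⟩
      simp [key, h]
    exact hle hw
  · intro h
    refine (Module.forall_dual_apply_eq_zero_iff Fq _).mp fun f => ?_
    rw [← key]
    exact h _ (Submodule.subset_span ⟨f, rfl⟩)

theorem rsupp_smul_le (α : K) (v : Fin n → K) : rsupp Fq K (α • v) ≤ rsupp Fq K v := by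
  refine Submodule.span_le.mpr ?_
  rintro _ ⟨f, rfl⟩
  exact Submodule.subset_span ⟨f ∘ₗ LinearMap.mulLeft Fq α, rfl⟩

theorem rsupp_smul {α : K} (hα : α ≠ 0) (v : Fin n → K) :
    rsupp Fq K (α • v) = rsupp Fq K v := by
  refine le_antisymm (rsupp_smul_le Fq K α v) ?_
  simpa [smul_smul, hα] using rsupp_smul_le Fq K α⁻¹ (α • v)

/-- A strictly larger kernel of `a ↦ ∑ i, a i • v i` means a strictly smaller rank weight. -/
theorem rankWt_lt_of_ker_lt {v w : Fin n → K}
    (h : LinearMap.ker (Fintype.linearCombination Fq v) <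
      LinearMap.ker (Fintype.linearCombination Fq w)) :
    rankWt Fq K w < rankWt Fq K v := by
  have hlt := Submodule.finrank_lt_finrank_of_lt h
  have hv := (Fintype.linearCombination Fq v).finrank_range_add_finrank_ker
  have hw := (Fintype.linearCombination Fq w).finrank_range_add_finrank_ker
  rw [rankWt_eq_finrank_range, rankWt_eq_finrank_range]
  omega

/-- If `u` and `v` have the same support, cancelling a nonzero coordinate of `v` in `u`
leaves a vector of smaller rank weight than `v`. -/
theorem rankWt_sub_smul_lt {u v : Fin n → K} (h : rsupp Fq K u = rsupp Fq K v) {i : Fin n}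
    (hi : v i ≠ 0) : rankWt Fq K (u - (u i / v i) • v) < rankWt Fq K v := by
  have hcomb : ∀ a, Fintype.linearCombination Fq (u - (u i / v i) • v) a =
      Fintype.linearCombination Fq u a - (u i / v i) * Fintype.linearCombination Fq v a := by
    intro a
    simp [Fintype.linearCombination_apply, smul_sub, Finset.mul_sum]
  apply rankWt_lt_of_ker_lt
  rw [SetLike.lt_iff_le_and_exists]
  refine ⟨fun a ha => ?_, Pi.single i 1, ?_, ?_⟩
  · rw [LinearMap.mem_ker] at ha ⊢
    have hua : Fintype.linearCombination Fq u a = 0 := by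
      rwa [linearCombination_eq_zero_iff, h, ← linearCombination_eq_zero_iff]
    rw [hcomb, ha, hua, mul_zero, sub_zero]
  · simp [Fintype.linearCombination_apply_single, hi]
  · simpa [Fintype.linearCombination_apply_single] using hi

end RankSupport

/-- Two minimum-weight codewords of a rank metric code have the same
support iff they are `K`-proportional. -/
theorem supp_eq_iff_proportional
    (Fq K : Type) [Field Fq] [Fintype Fq] [Field K] [Fintype K] [Algebra Fq K]
    (m n d : ℕ) (hm : Module.finrank Fq K = m) (hnm : n ≤ m)
    (C : Submodule K (Fin n → K)) (hmin : IsMinRankDist Fq K C d)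
    (u v : Fin n → K) (hu : u ∈ C) (hv : v ∈ C)
    (hwu : rankWt Fq K u = d) (hwv : rankWt Fq K v = d) :
    rsupp Fq K u = rsupp Fq K v ↔ ∃ α : K, α ≠ 0 ∧ u = α • v := by
  obtain ⟨⟨c, -, hc0, hcd⟩, hle⟩ := hmin
  have hd : 0 < d := hcd ▸ rankWt_pos Fq K hc0
  constructor
  · intro h
    have hv0 : v ≠ 0 := by
      rintro rfl
      rw [rankWt_zero] at hwv
      omega
    obtain ⟨i, hi⟩ := Function.ne_iff.mp hv0
    have huv : u = (u i / v i) • v := by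
      by_contra hne
      have hge := hle _ (C.sub_mem hu (C.smul_mem (u i / v i) hv)) (sub_ne_zero.mpr hne)
      exact (hwv ▸ rankWt_sub_smul_lt Fq K h hi).not_ge hge
    refine ⟨u i / v i, fun h0 => ?_, huv⟩
    rw [h0, zero_smul] at huv
    rw [huv, rankWt_zero] at hwu
    omega
  · rintro ⟨α, hα, rfl⟩
    exact rsupp_smul Fq K hα v
end

section
/- Let q be a prime power, n ≤ m, and let u, v ∈ F_{q^m}^n. Then there exist α, β ∈ F_{q^m} such that supp(α v + β u) = supp(v) + supp(u). -/
open Polynomial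

/-- If every `Fq`-linear relation among the entries of `w` holds among those of `v`, then the
support of `v` is contained in that of `w`. -/
theorem rsupp_le_rsupp {Fq K : Type} [Field Fq] [Field K] [Algebra Fq K] {n : ℕ}
    {v w : Fin n → K} (h : ∀ x : Fin n → Fq, ∑ i, x i • w i = 0 → ∑ i, x i • v i = 0) :
    rsupp Fq K v ≤ rsupp Fq K w := by
  refine Submodule.span_le.2 ?_
  rintro _ ⟨f, rfl⟩
  by_contra hf
  obtain ⟨φ, hφ, hker⟩ := Submodule.exists_le_ker_of_notMem hf
  have key : ∀ (g : K →ₗ[Fq] Fq) (z : Fin n → K),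
      φ (fun i => g (z i)) = g (∑ i, φ (Pi.single i 1) • z i) := by
    intro g z
    rw [LinearMap.pi_apply_eq_sum_univ φ, map_sum]
    refine Finset.sum_congr rfl fun i _ => ?_
    have hs : (fun j => if i = j then (1 : Fq) else 0) = Pi.single i 1 := by
      ext j
      simp [Pi.single_apply, eq_comm]
    rw [hs, map_smul, smul_eq_mul, smul_eq_mul, mul_comm]
  refine hφ ?_
  rw [key, h, map_zero]
  refine (Module.forall_dual_apply_eq_zero_iff Fq _).1 fun g => ?_
  rw [← key]
  exact hker (Submodule.subset_span ⟨g, rfl⟩)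

/-- The support of a `K`-linear combination lies in the sum of the supports. -/
theorem rsupp_add_le {Fq K : Type} [Field Fq] [Field K] [Algebra Fq K] {n : ℕ}
    (α β : K) (v u : Fin n → K) :
    rsupp Fq K (α • v + β • u) ≤ rsupp Fq K v ⊔ rsupp Fq K u := by
  refine Submodule.span_le.2 ?_
  rintro _ ⟨f, rfl⟩
  refine Submodule.mem_sup.2
    ⟨_, Submodule.subset_span ⟨f ∘ₗ LinearMap.mulLeft Fq α, rfl⟩,
      _, Submodule.subset_span ⟨f ∘ₗ LinearMap.mulLeft Fq β, rfl⟩, ?_⟩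
  ext i
  simp

/-- If `n ≤ [K : Fq]`, some `β` satisfies: a relation among the entries of `v + β u`
is a relation among the entries of `v` and of `u`. -/
theorem exists_forall_sum_smul_eq_zero {Fq K : Type} [Field Fq] [Finite Fq] [Field K] [Finite K]
    [Algebra Fq K] {n : ℕ} (hn : n ≤ Module.finrank Fq K) (u v : Fin n → K) :
    ∃ β : K, ∀ x : Fin n → Fq, ∑ i, x i • v i + β * ∑ i, x i • u i = 0 →
      ∑ i, x i • v i = 0 ∧ ∑ i, x i • u i = 0 := by
  by_contra! hcon
  have hsurj : Function.Surjective
      fun x : {x : Fin n → Fq // x ≠ 0} => -(∑ i, x.1 i • v i) / ∑ i, x.1 i • u i := by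
    intro β
    obtain ⟨x, hx, hne⟩ := hcon β
    have hu : ∑ i, x i • u i ≠ 0 := by
      intro hu
      rw [hu, mul_zero, add_zero] at hx
      exact hne hx hu
    refine ⟨⟨x, ?_⟩, ?_⟩
    · rintro rfl
      simp at hu
    · rw [div_eq_iff hu]
      linear_combination -hx
  have hlt : Nat.card {x : Fin n → Fq // x ≠ 0} < Nat.card (Fin n → Fq) :=
    Finite.card_subtype_lt (x := 0) (by simp)
  have hle := Nat.card_le_card_of_surjective _ hsurj
  rw [Module.natCard_eq_pow_finrank (K := Fq) (V := K)] at hle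
  rw [Nat.card_fun, Nat.card_fin] at hlt
  exact absurd (Nat.pow_le_pow_right Nat.card_pos hn) (not_le.2 (hle.trans_lt hlt))

/-- For `u, v ∈ K^n` there are scalars `α, β ∈ K` with
`supp(αv + βu) = supp(v) + supp(u)`. -/
theorem exists_supp_add_eq_sup
    (Fq K : Type) [Field Fq] [Fintype Fq] [Field K] [Fintype K] [Algebra Fq K]
    (m n : ℕ) (hm : Module.finrank Fq K = m) (hnm : n ≤ m)
    (u v : Fin n → K) :
    ∃ α β : K, rsupp Fq K (α • v + β • u) = rsupp Fq K v ⊔ rsupp Fq K u := by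
  subst hm
  obtain ⟨β, hβ⟩ := exists_forall_sum_smul_eq_zero hnm u v
  have h : ∀ x : Fin n → Fq, ∑ i, x i • ((1 : K) • v + β • u) i = 0 →
      ∑ i, x i • v i = 0 ∧ ∑ i, x i • u i = 0 := by
    intro x hx
    refine hβ x ?_
    rw [← hx, Finset.mul_sum, ← Finset.sum_add_distrib]
    simp
  exact ⟨1, β, le_antisymm (rsupp_add_le 1 β v u)
    (sup_le (rsupp_le_rsupp fun x hx => (h x hx).1) (rsupp_le_rsupp fun x hx => (h x hx).2))⟩
end

section
/- Let q be a prime power, d ≥ 2, 2d ≤ m, and let C ≤ F_{q^m}^{2d} be an F_{q^m}-linear code of dimension d whose minimum rank distance is d and whose dual C^⊥ (with respect to the standard inner product) also has minimum rank distance d, and assume C has no codeword of rank weight d+1 (A_{d+1}(C) = 0). Then the set D_d(C^⊥) = {supp(c) : c ∈ C^⊥, wt(c) = d} is also the set of blocks of a q-Steiner system S_q(d−1, d, 2d). -/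
open Polynomial

open Module

section DualCode

variable {K : Type} [Field K] {n : ℕ}

lemma mem_dualCode {C : Submodule K (Fin n → K)} {v : Fin n → K} :
    v ∈ dualCode K C ↔ ∀ u ∈ C, ∑ i, u i * v i = 0 := by
  simp [dualCode, Submodule.mem_iInf, dotL]

lemma mem_dualCode_span {s : Set (Fin n → K)} {v : Fin n → K} :
    v ∈ dualCode K (Submodule.span K s) ↔ ∀ u ∈ s, ∑ i, u i * v i = 0 := by
  refine mem_dualCode.trans ⟨fun h u hu => h u (Submodule.subset_span hu), fun h u hu => ?_⟩
  induction hu using Submodule.span_induction with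
  | mem u hu => exact h u hu
  | zero => simp
  | add a b _ _ ha hb => simp [add_mul, Finset.sum_add_distrib, ha, hb]
  | smul c a _ ha => simp [mul_assoc, ← Finset.mul_sum, ha]

lemma dualCode_sup (C D : Submodule K (Fin n → K)) :
    dualCode K (C ⊔ D) = dualCode K C ⊓ dualCode K D := by
  ext v
  simp only [Submodule.mem_inf, mem_dualCode]
  refine ⟨fun h => ⟨fun u hu => h u (Submodule.mem_sup_left hu),
    fun u hu => h u (Submodule.mem_sup_right hu)⟩, fun ⟨hC, hD⟩ u hu => ?_⟩
  obtain ⟨a, ha, b, hb, rfl⟩ := Submodule.mem_sup.1 hu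
  simp [add_mul, Finset.sum_add_distrib, hC a ha, hD b hb]

lemma le_dualCode_comm {C D : Submodule K (Fin n → K)} :
    C ≤ dualCode K D ↔ D ≤ dualCode K C := by
  suffices h : ∀ C D : Submodule K (Fin n → K), C ≤ dualCode K D → D ≤ dualCode K C from
    ⟨h C D, h D C⟩
  intro C D h v hv
  rw [mem_dualCode]
  intro u hu
  simpa only [mul_comm] using mem_dualCode.1 (h hu) v hv

lemma finrank_add_finrank_dualCode (C : Submodule K (Fin n → K)) :
    finrank K C + finrank K (dualCode K C) = n := by
  have hC : dualCode K C = (C.map (dotProductEquiv K (Fin n)).toLinearMap).dualCoannihilator := by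
    ext v
    simp only [mem_dualCode, Submodule.mem_dualCoannihilator, Submodule.mem_map,
      forall_exists_index, and_imp, forall_apply_eq_imp_iff₂]
    rfl
  have h := Subspace.finrank_add_finrank_dualCoannihilator_eq
    (C.map (dotProductEquiv K (Fin n)).toLinearMap)
  rwa [← hC, LinearEquiv.finrank_map_eq, finrank_fin_fun] at h

lemma dualCode_dualCode (C : Submodule K (Fin n → K)) : dualCode K (dualCode K C) = C := by
  refine (Submodule.eq_of_le_of_finrank_eq (le_dualCode_comm.1 le_rfl) ?_).symm
  have h₁ := finrank_add_finrank_dualCode C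
  have h₂ := finrank_add_finrank_dualCode (dualCode K C)
  omega

lemma finrank_dualCode_inf_dualCode (C D : Submodule K (Fin n → K)) :
    finrank K (dualCode K C ⊓ dualCode K D : Submodule K (Fin n → K)) + finrank K C + finrank K D =
      n + finrank K (C ⊓ D : Submodule K (Fin n → K)) := by
  have h₁ := finrank_add_finrank_dualCode (C ⊔ D)
  have h₂ := Submodule.finrank_sup_add_finrank_inf_eq C D
  rw [dualCode_sup] at h₁
  omega

end DualCode

section Extension

variable {Fq : Type} (K : Type) [Field Fq] [Field K] [Algebra Fq K] {n : ℕ}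

/-- The `K`-linear code spanned by an `Fq`-subspace of `Fq^n`. -/
def extendScalars (U : Submodule Fq (Fin n → Fq)) : Submodule K (Fin n → K) :=
  Submodule.span K ((fun u i => algebraMap Fq K (u i)) '' (U : Set (Fin n → Fq)))

variable {K}

lemma algebraMap_comp_mem_extendScalars {U : Submodule Fq (Fin n → Fq)} {u : Fin n → Fq}
    (hu : u ∈ U) : (fun i => algebraMap Fq K (u i)) ∈ extendScalars K U :=
  Submodule.subset_span ⟨u, hu, rfl⟩

lemma extendScalars_mono {U V : Submodule Fq (Fin n → Fq)} (h : U ≤ V) :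
    extendScalars K U ≤ extendScalars K V :=
  Submodule.span_mono (Set.image_mono h)

lemma finrank_extendScalars_le (U : Submodule Fq (Fin n → Fq)) :
    finrank K (extendScalars K U) ≤ finrank Fq U := by
  let b := finBasis Fq U
  let w : Fin (finrank Fq U) → Fin n → K := fun j i => algebraMap Fq K ((b j : Fin n → Fq) i)
  have hle : extendScalars K U ≤ Submodule.span K (Set.range w) := by
    refine Submodule.span_le.2 ?_
    rintro _ ⟨u, hu, rfl⟩
    have hu' : (fun i => algebraMap Fq K (u i)) =
        ∑ j, algebraMap Fq K (b.repr ⟨u, hu⟩ j) • w j := by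
      have h := congrArg Subtype.val (b.sum_repr ⟨u, hu⟩)
      rw [Submodule.coe_sum] at h
      ext i
      have hi := congrArg (algebraMap Fq K) (congrFun h i)
      simpa [w, Finset.sum_apply, Algebra.smul_def, -Basis.sum_repr] using hi.symm
    simp only [SetLike.mem_coe, hu']
    exact Submodule.sum_mem _ fun j _ =>
      Submodule.smul_mem _ _ (Submodule.subset_span ⟨j, rfl⟩)
  calc finrank K (extendScalars K U) ≤ finrank K (Submodule.span K (Set.range w)) :=
        Submodule.finrank_mono hle
    _ ≤ finrank Fq U := by simpa [Set.finrank] using finrank_range_le_card (R := K) w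

lemma finrank_extendScalars (U : Submodule Fq (Fin n → Fq)) :
    finrank K (extendScalars K U) = finrank Fq U := by
  obtain ⟨V, hUV⟩ := Submodule.exists_isCompl U
  have htop : extendScalars K U ⊔ extendScalars K V = ⊤ := by
    rw [eq_top_iff, ← (Pi.basisFun K (Fin n)).span_eq, Submodule.span_le]
    rintro _ ⟨i, rfl⟩
    obtain ⟨u, hu, v, hv, huv⟩ := Submodule.mem_sup.1
      (hUV.sup_eq_top ▸ Submodule.mem_top : (Pi.single i 1 : Fin n → Fq) ∈ U ⊔ V)
    refine Submodule.mem_sup.2 ⟨_, algebraMap_comp_mem_extendScalars hu, _,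
      algebraMap_comp_mem_extendScalars hv, ?_⟩
    ext j
    have hj := congrArg (algebraMap Fq K) (congrFun huv j)
    rw [Pi.add_apply, map_add] at hj
    rw [Pi.add_apply, hj, Pi.basisFun_apply]
    by_cases h : j = i <;> simp [h]
  have h₁ := Submodule.finrank_add_le_finrank_add_finrank (extendScalars K U) (extendScalars K V)
  have h₂ := Submodule.finrank_add_eq_of_isCompl hUV
  have h₃ := finrank_extendScalars_le (K := K) U
  have h₄ := finrank_extendScalars_le (K := K) V
  rw [htop, finrank_top] at h₁
  simp only [finrank_fin_fun] at h₁ h₂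
  omega

lemma mem_dualCode_extendScalars {U : Submodule Fq (Fin n → Fq)} {v : Fin n → K} :
    v ∈ dualCode K (extendScalars K U) ↔ ∀ u ∈ U, ∑ i, algebraMap Fq K (u i) * v i = 0 := by
  rw [extendScalars, mem_dualCode_span, Set.forall_mem_image]
  rfl

lemma dualCode_extendScalars (U : Submodule Fq (Fin n → Fq)) :
    dualCode K (extendScalars K U) = extendScalars K (dualCode Fq U) := by
  refine (Submodule.eq_of_le_of_finrank_eq ?_ ?_).symm
  · refine Submodule.span_le.2 ?_
    rintro _ ⟨v, hv, rfl⟩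
    refine mem_dualCode_extendScalars.2 fun u hu => ?_
    simpa using congrArg (algebraMap Fq K) (mem_dualCode.1 hv u hu)
  · have h₁ := finrank_add_finrank_dualCode (extendScalars K U)
    have h₂ := finrank_add_finrank_dualCode U
    rw [finrank_extendScalars] at h₁ ⊢
    omega

lemma mem_dualCode_extendScalars_iff_rsupp_le {U : Submodule Fq (Fin n → Fq)} {v : Fin n → K} :
    v ∈ dualCode K (extendScalars K U) ↔ rsupp Fq K v ≤ dualCode Fq U := by
  rw [mem_dualCode_extendScalars, rsupp, Submodule.span_le]
  constructor
  · rintro h _ ⟨f, rfl⟩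
    refine mem_dualCode.2 fun u hu => ?_
    simpa [← Algebra.smul_def] using congrArg f (h u hu)
  · intro h u hu
    refine (forall_dual_apply_eq_zero_iff Fq _).1 fun f => ?_
    simpa [← Algebra.smul_def] using mem_dualCode.1 (h ⟨f, rfl⟩) u hu

lemma mem_extendScalars {U : Submodule Fq (Fin n → Fq)} {v : Fin n → K} :
    v ∈ extendScalars K U ↔ rsupp Fq K v ≤ U := by
  simpa [dualCode_extendScalars, dualCode_dualCode] using
    mem_dualCode_extendScalars_iff_rsupp_le (U := dualCode Fq U) (v := v)

lemma finrank_rsupp [FiniteDimensional Fq K] (v : Fin n → K) :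
    finrank Fq (rsupp Fq K v) = rankWt Fq K v := by
  let g := Fintype.linearCombination Fq v
  let e := LinearEquiv.piRing Fq Fq (Fin n) Fq
  have hr : rsupp Fq K v = (LinearMap.range g.dualMap).map e.toLinearMap := by
    rw [← LinearMap.range_comp, rsupp]
    refine (Submodule.span_eq_of_le _ ?_ ?_)
    · rintro _ ⟨f, rfl⟩
      refine ⟨f, ?_⟩
      ext i
      simp [e, g, LinearEquiv.piRing_apply, Fintype.linearCombination_apply_single]
    · rintro _ ⟨f, rfl⟩
      refine Submodule.subset_span ⟨f, ?_⟩
      ext i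
      simp [e, g, LinearEquiv.piRing_apply, Fintype.linearCombination_apply_single]
  rw [hr, LinearEquiv.finrank_map_eq, LinearMap.finrank_range_dualMap_eq_finrank_range,
    Fintype.range_linearCombination, rankWt]

end Extension

/-- A codeword of minimum weight in `C` supported in `S` has support exactly `S`, provided that
the dimension of `S` does not exceed that weight. -/
lemma rsupp_eq_of_mem {Fq K : Type} [Field Fq] [Field K] [Algebra Fq K] [FiniteDimensional Fq K]
    {n d : ℕ} {C : Submodule K (Fin n → K)} (hC : ∀ c ∈ C, c ≠ 0 → d ≤ rankWt Fq K c)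
    {S : Submodule Fq (Fin n → Fq)} (hS : finrank Fq S ≤ d) {c : Fin n → K} (hc : c ∈ C)
    (hc0 : c ≠ 0) (hcS : c ∈ extendScalars K S) : rsupp Fq K c = S :=
  Submodule.eq_of_le_of_finrank_le (mem_extendScalars.1 hcS)
    (by rw [finrank_rsupp]; exact hS.trans (hC c hc hc0))

/-- Under the hypotheses of the previous theorem, the supports of the
minimum weight codewords of the dual code `C^⊥` also form the blocks of a
`q`-Steiner system `S_q(d−1, d, 2d)`. -/
theorem steiner_system_of_dual_of_dually_AMRD
    (Fq K : Type) [Field Fq] [Fintype Fq] [Field K] [Fintype K] [Algebra Fq K]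
    (m d : ℕ) (hd2 : 2 ≤ d) (hm : Module.finrank Fq K = m) (hdm : 2 * d ≤ m)
    (C : Submodule K (Fin (2 * d) → K)) (hdim : Module.finrank K C = d)
    (hmin : IsMinRankDist Fq K C d)
    (hmin' : IsMinRankDist Fq K (dualCode K C) d)
    (hA : ∀ c ∈ C, rankWt Fq K c ≠ d + 1) :
    IsSteinerSystemQ Fq (d - 1) d (2 * d)
      {S : Submodule Fq (Fin (2 * d) → Fq) |
        ∃ c ∈ dualCode K C, rankWt Fq K c = d ∧ rsupp Fq K c = S} := by
  have : FiniteDimensional Fq K := Module.Finite.of_finite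
  obtain ⟨-, hC⟩ := hmin
  obtain ⟨-, hC'⟩ := hmin'
  have hdual (U : Submodule Fq (Fin (2 * d) → Fq)) :
      finrank K (dualCode K C ⊓ extendScalars K (dualCode Fq U) : Submodule K _) + finrank Fq U =
        d + finrank K (C ⊓ extendScalars K U : Submodule K _) := by
    have h := finrank_dualCode_inf_dualCode C (extendScalars K U)
    rw [dualCode_extendScalars, hdim, finrank_extendScalars] at h
    omega
  refine ⟨?_, fun W hW => ?_⟩
  · rintro _ ⟨c, -, hc, rfl⟩
    rw [finrank_rsupp, hc]
  have hWd := finrank_add_finrank_dualCode W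
  -- the shortened code supported in `Wᗮ` is one-dimensional
  have hone : finrank K (C ⊓ extendScalars K (dualCode Fq W) : Submodule K _) = 1 := by
    have hbot : dualCode K C ⊓ extendScalars K W = ⊥ := by
      refine (Submodule.eq_bot_iff _).2 fun c hc => by_contra fun hc0 => ?_
      have h₁ := hC' c hc.1 hc0
      have h₂ := rsupp_eq_of_mem hC' (by omega) hc.1 hc0 hc.2
      rw [← finrank_rsupp, h₂] at h₁
      omega
    have h := hdual (dualCode Fq W)
    rw [dualCode_dualCode, hbot, finrank_bot] at h
    omega
  obtain ⟨⟨c, hcC, hcW⟩, hc0, hspan⟩ := finrank_eq_one_iff'.1 hone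
  replace hc0 : c ≠ 0 := fun h => hc0 (Subtype.ext h)
  have hcd : finrank Fq (rsupp Fq K c) = d := by
    have h₁ := Submodule.finrank_mono (mem_extendScalars.1 hcW)
    have h₂ := hC c hcC hc0
    have h₃ := hA c hcC
    rw [finrank_rsupp] at h₁ ⊢
    omega
  have hcd' := finrank_add_finrank_dualCode (rsupp Fq K c)
  refine ⟨dualCode Fq (rsupp Fq K c), ⟨?_, ?_⟩, ?_⟩
  · have hcS : c ∈ C ⊓ extendScalars K (rsupp Fq K c) := ⟨hcC, mem_extendScalars.2 le_rfl⟩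
    have hpos : 0 < finrank K (C ⊓ extendScalars K (rsupp Fq K c) : Submodule K _) :=
      finrank_pos_iff_exists_ne_zero.2 ⟨⟨c, hcS⟩, fun h => hc0 (congrArg Subtype.val h)⟩
    have h := hdual (rsupp Fq K c)
    obtain ⟨⟨x, hxC, hxS⟩, hx0⟩ := finrank_pos_iff_exists_ne_zero.1
      (show 0 < finrank K (dualCode K C ⊓ extendScalars K (dualCode Fq (rsupp Fq K c)) :
        Submodule K _) by omega)
    have hx := rsupp_eq_of_mem hC' (by omega) hxC (fun h => hx0 (Subtype.ext h)) hxS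
    exact ⟨x, hxC, by rw [← finrank_rsupp, hx]; omega, hx⟩
  · exact le_dualCode_comm.1 (mem_extendScalars.1 hcW)
  · rintro _ ⟨⟨x, hxC, hxd, rfl⟩, hWx⟩
    have hx0 : x ≠ 0 := by
      rintro rfl
      have h : Submodule.span Fq (Set.range (0 : Fin (2 * d) → K)) = ⊥ := by
        simp [Submodule.span_eq_bot]
      rw [rankWt, h, finrank_bot] at hxd
      omega
    rw [← finrank_rsupp] at hxd
    have hxd' := finrank_add_finrank_dualCode (rsupp Fq K x)
    have hpos : 0 < finrank K (dualCode K C ⊓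
        extendScalars K (dualCode Fq (dualCode Fq (rsupp Fq K x))) : Submodule K _) := by
      rw [dualCode_dualCode]
      exact finrank_pos_iff_exists_ne_zero.2
        ⟨⟨x, hxC, mem_extendScalars.2 le_rfl⟩, fun h => hx0 (congrArg Subtype.val h)⟩
    have h := hdual (dualCode Fq (rsupp Fq K x))
    obtain ⟨⟨y, hyC, hyS⟩, hy0⟩ := finrank_pos_iff_exists_ne_zero.1
      (show 0 < finrank K (C ⊓ extendScalars K (dualCode Fq (rsupp Fq K x)) :
        Submodule K _) by omega)
    obtain ⟨a, ha⟩ := hspan ⟨y, hyC, extendScalars_mono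
      (le_dualCode_comm.1 (by rwa [dualCode_dualCode])) hyS⟩
    have hy : a • c = y := congrArg Subtype.val ha
    replace hy0 : y ≠ 0 := fun h => hy0 (Subtype.ext h)
    have hyc : y ∈ extendScalars K (rsupp Fq K c) :=
      hy ▸ Submodule.smul_mem _ a (mem_extendScalars.2 le_rfl)
    rw [← rsupp_eq_of_mem hC hcd.le hyC hy0 hyc,
      rsupp_eq_of_mem hC (by omega) hyC hy0 hyS, dualCode_dualCode]
end

section
/- Let q be a prime power, d ≥ 2, 2d ≤ m, and let C ≤ F_{q^m}^{2d} be an F_{q^m}-linear code of dimension d whose minimum rank distance is d and whose dual C^⊥ (with respect to the standard inner product) also has minimum rank distance d, and assume C has no codeword of rank weight d+1 (A_{d+1}(C) = 0). Then d is even. -/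
open Polynomial

open Module

theorem two_dvd_of_sq_sub_one_dvd_pow_sub_one {q k : ℕ} (hq : 2 ≤ q)
    (h : q ^ 2 - 1 ∣ q ^ k - 1) : 2 ∣ k := by
  have h1 := Nat.pow_sub_one_gcd_pow_sub_one q 2 k
  rw [Nat.gcd_eq_left h] at h1
  have h2 : q ^ 2 = q ^ (Nat.gcd 2 k) := by
    have := Nat.one_le_pow 2 q (by omega)
    have := Nat.one_le_pow (Nat.gcd 2 k) q (by omega)
    omega
  exact Nat.gcd_eq_left_iff_dvd.mp (Nat.pow_right_injective hq h2).symm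

theorem exists_submodule_finrank_eq {K V : Type*} [Field K] [AddCommGroup V] [Module K V] {r : ℕ}
    (hr : r ≤ finrank K V) : ∃ W : Submodule K V, finrank K W = r := by
  obtain ⟨b, hb⟩ := exists_linearIndependent_of_le_finrank hr
  exact ⟨Submodule.span K (Set.range b), by rw [finrank_span_eq_card hb, Fintype.card_fin]⟩

section Partition

variable {Fq K V E : Type*} [Field Fq] [Field K] [Algebra Fq K]
  [AddCommGroup V] [Module Fq V] [AddCommGroup E] [Module K E] [Module Fq E] [IsScalarTower Fq K E]

variable (K) in
/-- The vectors of `V` which `Φ` sends into the `K`-span of the image of `X`. -/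
def spanClosure (Φ : V →ₗ[Fq] E) (X : Submodule Fq V) : Submodule Fq V :=
  ((Submodule.span K (Φ '' X)).restrictScalars Fq).comap Φ

theorem mem_spanClosure {Φ : V →ₗ[Fq] E} {X : Submodule Fq V} {x : V} :
    x ∈ spanClosure K Φ X ↔ Φ x ∈ Submodule.span K (Φ '' X) := Iff.rfl

theorem le_spanClosure (Φ : V →ₗ[Fq] E) (X : Submodule Fq V) : X ≤ spanClosure K Φ X :=
  fun x hx => Submodule.subset_span ⟨x, hx, rfl⟩

theorem finrank_sup_span_singleton_of_notMem [FiniteDimensional Fq V] {W : Submodule Fq V} {x : V}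
    (hx : x ∉ W) : finrank Fq (W ⊔ Fq ∙ x : Submodule Fq V) = finrank Fq W + 1 := by
  have hx0 : x ≠ 0 := fun h => hx (h ▸ W.zero_mem)
  have hinf : W ⊓ Fq ∙ x = ⊥ := ((Submodule.disjoint_span_singleton' hx0).mpr hx).eq_bot
  have h := Submodule.finrank_sup_add_finrank_inf_eq W (Fq ∙ x)
  rwa [hinf, finrank_bot, finrank_span_singleton hx0, add_zero] at h

theorem finrank_spanClosure_eq [FiniteDimensional Fq V] [FiniteDimensional K E] {d : ℕ}
    (hE : finrank K E = d + 1) {Φ : V →ₗ[Fq] E}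
    (hind : ∀ X : Submodule Fq V, finrank Fq X ≤ d →
      finrank K (Submodule.span K (Φ '' X)) = finrank Fq X)
    (hker : ∀ f : Dual K E, f ≠ 0 →
      finrank Fq (LinearMap.ker (f.restrictScalars Fq ∘ₗ Φ)) ≤ d + 1 ∧
      finrank Fq (LinearMap.ker (f.restrictScalars Fq ∘ₗ Φ)) ≠ d)
    {X : Submodule Fq V} (hX : finrank Fq X = d) :
    finrank Fq (spanClosure K Φ X) = d + 1 := by
  have hH := (hind X hX.le).trans hX
  have hlt : Submodule.span K (Φ '' X) < ⊤ := by
    refine lt_top_iff_ne_top.mpr fun h => ?_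
    rw [h, finrank_top] at hH
    omega
  obtain ⟨f, hf0, hf⟩ := Submodule.exists_le_ker_of_lt_top _ hlt
  have hfker : Submodule.span K (Φ '' X) = LinearMap.ker f := by
    refine Submodule.eq_of_le_of_finrank_le hf ?_
    have := Module.Dual.finrank_ker_add_one_of_ne_zero hf0
    omega
  have hS : spanClosure K Φ X = LinearMap.ker (f.restrictScalars Fq ∘ₗ Φ) := by
    ext x
    rw [mem_spanClosure, hfker]
    rfl
  have hle := Submodule.finrank_mono (le_spanClosure (K := K) Φ X)
  obtain ⟨h1, h2⟩ := hker f hf0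
  rw [hS] at hle ⊢
  omega

theorem spanClosure_eq_of_mem [FiniteDimensional Fq V] [FiniteDimensional K E] {d : ℕ}
    {Φ : V →ₗ[Fq] E}
    (hind : ∀ X : Submodule Fq V, finrank Fq X ≤ d →
      finrank K (Submodule.span K (Φ '' X)) = finrank Fq X)
    {X Y : Submodule Fq V} (hX : finrank Fq X = d) (hY : finrank Fq Y = d)
    (h : Y ≤ spanClosure K Φ X) : spanClosure K Φ Y = spanClosure K Φ X := by
  have hspan : Submodule.span K (Φ '' Y) = Submodule.span K (Φ '' X) := by
    refine Submodule.eq_of_le_of_finrank_eq ?_ ?_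
    · rw [Submodule.span_le]
      rintro _ ⟨y, hy, rfl⟩
      exact h hy
    · rw [hind Y hY.le, hind X hX.le, hX, hY]
  simp only [spanClosure, hspan]

theorem card_sub_card_dvd [Fintype Fq] [FiniteDimensional Fq V] [FiniteDimensional K E] {e : ℕ}
    (hE : finrank K E = e + 2) {Φ : V →ₗ[Fq] E}
    (hind : ∀ X : Submodule Fq V, finrank Fq X ≤ e + 1 →
      finrank K (Submodule.span K (Φ '' X)) = finrank Fq X)
    (hker : ∀ f : Dual K E, f ≠ 0 →
      finrank Fq (LinearMap.ker (f.restrictScalars Fq ∘ₗ Φ)) ≤ e + 2 ∧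
      finrank Fq (LinearMap.ker (f.restrictScalars Fq ∘ₗ Φ)) ≠ e + 1)
    {W : Submodule Fq V} (hW : finrank Fq W = e) :
    Fintype.card Fq ^ (e + 2) - Fintype.card Fq ^ e ∣
      Fintype.card Fq ^ finrank Fq V - Fintype.card Fq ^ e := by
  classical
  have : Finite V := Module.finite_of_finite Fq
  have := Fintype.ofFinite V
  have hcard (A : Submodule Fq V) (hA : W ≤ A) :
      (Finset.univ.filter fun x => x ∈ A ∧ x ∉ W).card =
        Fintype.card Fq ^ finrank Fq A - Fintype.card Fq ^ e := by
    rw [← hW, ← Module.card_eq_pow_finrank (K := Fq) (V := A),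
      ← Module.card_eq_pow_finrank (K := Fq) (V := W), Fintype.card_subtype, Fintype.card_subtype,
      Finset.filter_and_not, Finset.card_sdiff_of_subset]
    exact Finset.monotone_filter_right _ fun x _ hx => hA hx
  let S (x : V) : Submodule Fq V := spanClosure K Φ (W ⊔ Fq ∙ x)
  have hrank {x : V} (hx : x ∉ W) : finrank Fq (W ⊔ Fq ∙ x : Submodule Fq V) = e + 1 := by
    rw [finrank_sup_span_singleton_of_notMem hx, hW]
  have hWS (x : V) : W ≤ S x := le_sup_left.trans (le_spanClosure Φ _)
  have hmem (x : V) : x ∈ S x :=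
    le_spanClosure Φ _ (Submodule.mem_sup_right (Submodule.mem_span_singleton_self x))
  have hfib {x y : V} (hx : x ∉ W) (hy : y ∉ W) : S y = S x ↔ y ∈ S x := by
    refine ⟨fun h => h ▸ hmem y, fun h => spanClosure_eq_of_mem hind (hrank hx) (hrank hy) ?_⟩
    exact sup_le (hWS x) ((Submodule.span_singleton_le_iff_mem _ _).mpr h)
  have htop := hcard ⊤ le_top
  rw [finrank_top] at htop
  rw [← htop, Finset.card_eq_sum_card_image S]
  refine Finset.dvd_sum fun A hA => ?_
  obtain ⟨x, hx, rfl⟩ := Finset.mem_image.mp hA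
  have hxW : x ∉ W := by simpa using hx
  have hSx := hcard (S x) (hWS x)
  rw [finrank_spanClosure_eq hE hind hker (hrank hxW)] at hSx
  rw [← hSx]
  refine dvd_of_eq (congrArg Finset.card ?_)
  ext y
  simp only [Finset.mem_filter, Finset.mem_univ, true_and, Submodule.mem_top]
  constructor
  · rintro ⟨h1, h2⟩
    exact ⟨h2, (hfib hxW h2).mpr h1⟩
  · rintro ⟨h1, h2⟩
    exact ⟨(hfib hxW h1).mp h2, h1⟩

end Partition

section Code

variable {Fq K : Type} [Field Fq] [Field K] [Algebra Fq K] {n : ℕ}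

variable (Fq) in
/-- The map sending `x ∈ Fq^n` to the functional `c ↦ ∑ i, x i • c i` on the code `C`. -/
def codeEval (C : Submodule K (Fin n → K)) : (Fin n → Fq) →ₗ[Fq] Dual K C where
  toFun x := dotL K (fun i => algebraMap Fq K (x i)) ∘ₗ C.subtype
  map_add' x y := by
    ext c
    simp [dotL, add_mul, Finset.sum_add_distrib]
  map_smul' a x := by
    ext c
    simp [dotL, Finset.mul_sum, Algebra.smul_def, mul_assoc]

theorem codeEval_apply (C : Submodule K (Fin n → K)) (x : Fin n → Fq) (c : C) :
    codeEval Fq C x c = ∑ i, x i • (c : Fin n → K) i := by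
  simp [codeEval, dotL, Algebra.smul_def]

theorem finrank_ker_linearCombination_add_rankWt (c : Fin n → K) :
    finrank Fq (LinearMap.ker (Fintype.linearCombination Fq c)) + rankWt Fq K c = n := by
  have h := LinearMap.finrank_range_add_finrank_ker (Fintype.linearCombination Fq c)
  rw [Fintype.range_linearCombination, finrank_fin_fun] at h
  rw [rankWt, add_comm, h]

theorem rankWt_sum_smul_le {r : ℕ} (l : Fin r → K) (b : Fin r → Fin n → Fq) :
    rankWt Fq K (fun i => ∑ j, b j i • l j) ≤ r := by
  have hle : Submodule.span Fq (Set.range fun i => ∑ j, b j i • l j) ≤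
      Submodule.span Fq (Set.range l) := by
    rw [Submodule.span_le]
    rintro _ ⟨i, rfl⟩
    exact Submodule.sum_mem _ fun j _ => Submodule.smul_mem _ _ (Submodule.subset_span ⟨j, rfl⟩)
  have : FiniteDimensional Fq (Submodule.span Fq (Set.range l)) :=
    FiniteDimensional.span_of_finite Fq (Set.finite_range l)
  exact (Submodule.finrank_mono hle).trans ((finrank_range_le_card l).trans_eq (Fintype.card_fin r))

theorem eq_zero_of_sum_smul_eq_zero {r : ℕ} {b : Fin r → Fin n → Fq}
    (hb : LinearIndependent Fq b) {l : Fin r → K} (h : ∀ i, ∑ j, b j i • l j = 0) : l = 0 := by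
  funext j
  refine (Module.forall_dual_apply_eq_zero_iff Fq (l j)).mp fun f => ?_
  refine Fintype.linearIndependent_iff.mp hb (fun j => f (l j)) ?_ j
  ext i
  have := congrArg f (h i)
  simpa [mul_comm] using this

theorem linearIndependent_codeEval {C : Submodule K (Fin n → K)} {d : ℕ}
    (hC : ∀ c ∈ dualCode K C, c ≠ 0 → d ≤ rankWt Fq K c) {r : ℕ} (hr : r < d)
    {b : Fin r → Fin n → Fq} (hb : LinearIndependent Fq b) :
    LinearIndependent K fun j => codeEval Fq C (b j) := by
  rw [Fintype.linearIndependent_iff]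
  intro l hl
  refine congrFun (eq_zero_of_sum_smul_eq_zero hb fun i => ?_)
  have hmem : (fun i => ∑ j, b j i • l j) ∈ dualCode K C := by
    simp only [dualCode, Submodule.mem_iInf]
    intro c hc
    have h := LinearMap.congr_fun hl ⟨c, hc⟩
    simp only [LinearMap.sum_apply, LinearMap.smul_apply, codeEval_apply, LinearMap.zero_apply,
      Finset.smul_sum] at h
    rw [Finset.sum_comm] at h
    rw [LinearMap.mem_ker, ← h]
    simp only [dotL, LinearMap.coe_mk, AddHom.coe_mk, Finset.mul_sum]
    refine Finset.sum_congr rfl fun i _ => Finset.sum_congr rfl fun j _ => ?_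
    rw [mul_smul_comm, smul_comm, smul_eq_mul, mul_comm]
  by_contra hne
  have h0 : (fun i => ∑ j, b j i • l j) ≠ 0 := fun h0 => hne (congrFun h0 i)
  have := hC _ hmem h0
  have := rankWt_sum_smul_le l b
  omega

theorem finrank_span_codeEval_image {C : Submodule K (Fin n → K)} {d : ℕ}
    (hC : ∀ c ∈ dualCode K C, c ≠ 0 → d ≤ rankWt Fq K c) {X : Submodule Fq (Fin n → Fq)}
    (hX : finrank Fq X < d) :
    finrank K (Submodule.span K (codeEval Fq C '' X)) = finrank Fq X := by
  let b := finBasis Fq X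
  have hb : LinearIndependent Fq fun j => (b j : Fin n → Fq) :=
    b.linearIndependent.map' X.subtype X.ker_subtype
  have hXb : X = Submodule.span Fq (Set.range fun j => (b j : Fin n → Fq)) := by
    have h := congrArg (Submodule.map X.subtype) b.span_eq
    rw [Submodule.map_span, Submodule.map_top, Submodule.range_subtype, ← Set.range_comp] at h
    exact h.symm
  have hspan : Submodule.span K (codeEval Fq C '' X) =
      Submodule.span K (Set.range fun j => codeEval Fq C (b j)) := by
    conv_lhs => rw [hXb, ← Submodule.map_coe, Submodule.map_span, Submodule.span_span_of_tower,
      ← Set.range_comp]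
    rfl
  rw [hspan, finrank_span_eq_card (linearIndependent_codeEval hC hX hb), Fintype.card_fin]

end Code

/-- For a `[2d,d,d]` dually AMRD code with no codewords of rank
weight `d+1`, the number `d` is even. -/
theorem even_of_dually_AMRD
    (Fq K : Type) [Field Fq] [Fintype Fq] [Field K] [Fintype K] [Algebra Fq K]
    (m d : ℕ) (hd2 : 2 ≤ d) (hm : Module.finrank Fq K = m) (hdm : 2 * d ≤ m)
    (C : Submodule K (Fin (2 * d) → K)) (hdim : Module.finrank K C = d)
    (hmin : IsMinRankDist Fq K C d)
    (hmin' : IsMinRankDist Fq K (dualCode K C) d)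
    (hA : ∀ c ∈ C, rankWt Fq K c ≠ d + 1) :
    Even d := by
  obtain ⟨e, rfl⟩ := Nat.exists_eq_add_of_le' hd2
  obtain ⟨W, hW⟩ := exists_submodule_finrank_eq (K := Fq) (V := Fin (2 * (e + 2)) → Fq)
    (r := e) (by rw [finrank_fin_fun]; omega)
  have hdvd := card_sub_card_dvd (K := K) (Φ := codeEval Fq C)
    (by rw [Subspace.dual_finrank_eq, hdim])
    (fun X hX => finrank_span_codeEval_image hmin'.2 (Nat.lt_succ_of_le hX)) (fun f hf => ?_) hW
  · have hq := Fintype.one_lt_card (α := Fq)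
    rw [finrank_fin_fun, show 2 * (e + 2) = e + (e + 4) by ring, pow_add, pow_add,
      ← Nat.mul_sub_one, ← Nat.mul_sub_one] at hdvd
    have := two_dvd_of_sq_sub_one_dvd_pow_sub_one hq
      (Nat.dvd_of_mul_dvd_mul_left (by positivity) hdvd)
    rw [even_iff_two_dvd]
    omega
  · obtain ⟨c, rfl⟩ := (evalEquiv K C).surjective f
    have hc : (c : Fin (2 * (e + 2)) → K) ≠ 0 := by
      rintro h
      rw [Submodule.coe_eq_zero] at h
      exact hf (by rw [h, map_zero])
    have hmap : (evalEquiv K C c).restrictScalars Fq ∘ₗ codeEval Fq C =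
        Fintype.linearCombination Fq (c : Fin (2 * (e + 2)) → K) := by
      refine LinearMap.ext fun x => ?_
      simp [codeEval_apply, Fintype.linearCombination_apply]
    have h1 := finrank_ker_linearCombination_add_rankWt (Fq := Fq) (c : Fin (2 * (e + 2)) → K)
    have h2 := hmin.2 c c.2 hc
    have h3 := hA c c.2
    rw [hmap]
    omega
end
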